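/- arXiv:1908.07351 — 2 statements merged into one kernel-verified Lean document; each statement's English description precedes it below -/
import Mathlib

section
/- Let f : ℂⁿ → ℂ be an entire function such that f(z) = 0 for every z ∈ Hⁿ, where Hⁿ = {z ∈ ℂⁿ : z_j ∈ 2ℤ for some j ∈ {1,…,n}}. Then there exists an entire function g : ℂⁿ → ℂ such that f(z) = sic_n(πz)·g(z) for all z ∈ ℂⁿ, where sic_n(πz) = ∏_{j=1}^n sin(πz_j/2). -/
open Complex Real

lemma aux_param {n : ℕ} (K : ℝ → (Fin n → ℂ) → ℂ) (hK : Continuous K.uncurry)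
    (hd : ∀ t, Differentiable ℂ (K t)) (a b : ℝ) :
    Differentiable ℂ (fun z => ∫ t in a..b, K t z) := by
  intro z0
  have hcomp : IsCompact (Set.uIcc a b ×ˢ Metric.closedBall z0 2) :=
    isCompact_uIcc.prod (isCompact_closedBall _ _)
  obtain ⟨C, hC⟩ := hcomp.exists_bound_of_continuousOn hK.continuousOn
  have hKz : ∀ z, Continuous (fun t => K t z) := fun z =>
    hK.comp (by fun_prop : Continuous fun t : ℝ => (t, z))
  refine (intervalIntegral.hasFDerivAt_integral_of_dominated_of_fderiv_le
    (F := fun z t => K t z) (F' := fun z t => fderiv ℂ (K t) z) (bound := fun _ => (2 * C) / 1)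
    (Metric.ball_mem_nhds z0 one_pos) ?_ ?_ ?_ ?_ ?_ ?_).differentiableAt
  · exact Filter.Eventually.of_forall fun z => (hKz z).aestronglyMeasurable
  · exact (hKz z0).intervalIntegrable _ _
  · have := (measurable_fderiv_with_param ℂ hK).comp
      (by fun_prop : Measurable fun t : ℝ => (t, z0))
    exact this.aestronglyMeasurable
  · refine Filter.Eventually.of_forall fun t ht z hz => ?_
    have ht' := Set.uIoc_subset_uIcc ht
    refine Complex.norm_fderiv_le_div_of_mapsTo_ball (hd t).differentiableOn ?_ one_pos
    intro w hw
    have h1 := hC (t, w) ⟨ht', by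
      simp only [Metric.mem_ball, Metric.mem_closedBall] at *
      linarith [dist_triangle w z z0]⟩
    have h2 := hC (t, z) ⟨ht', by
      simp only [Metric.mem_ball, Metric.mem_closedBall] at *
      linarith⟩
    simp only [Function.uncurry] at h1 h2
    rw [Metric.mem_closedBall, dist_eq_norm]
    linarith [norm_sub_le (K t w) (K t z)]
  · exact intervalIntegrable_const
  · exact Filter.Eventually.of_forall fun t _ z _ => (hd t z).hasFDerivAt

lemma aux_line {n : ℕ} {f : (Fin n → ℂ) → ℂ} (hf : Differentiable ℂ f) (z e : Fin n → ℂ) (w : ℂ) :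
    HasDerivAt (fun w : ℂ => f (z + w • e)) (fderiv ℂ f (z + w • e) e) w := by
  have h : HasDerivAt (fun w : ℂ => z + w • e) e w := by
    simpa using ((hasDerivAt_id w).smul_const e).const_add z
  exact (hf (z + w • e)).hasFDerivAt.comp_hasDerivAt w h

lemma aux_deriv {n : ℕ} {f : (Fin n → ℂ) → ℂ} (hf : Differentiable ℂ f) (e : Fin n → ℂ) :
    Differentiable ℂ (fun z => fderiv ℂ f z e) := by
  have key : (fun z => fderiv ℂ f z e) = fun z => (2 * π * I : ℂ)⁻¹ •
      ∫ θ in (0:ℝ)..2 * π, (circleMap 0 1 θ * I) *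
        (((circleMap 0 1 θ) ^ 2)⁻¹ * f (z + circleMap 0 1 θ • e)) := by
    funext z
    have h1 := Complex.two_pi_I_inv_smul_circleIntegral_sub_sq_inv_smul_of_differentiable
      (f := fun w : ℂ => f (z + w • e)) isOpen_univ (c := 0) (w₀ := 0) (R := 1)
      (Set.subset_univ _) (fun w _ => (aux_line hf z e w).differentiableAt.differentiableWithinAt)
      (by simp)
    rw [(aux_line hf z e 0).deriv] at h1
    simp only [circleIntegral, deriv_circleMap, smul_eq_mul, sub_zero, zero_smul, add_zero] at h1
    rw [← h1, smul_eq_mul]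
  rw [key]
  refine Differentiable.const_smul (R := ℂ) (c := (2 * π * I : ℂ)⁻¹)
    (aux_param (fun θ z => (circleMap 0 1 θ * I) *
        (((circleMap 0 1 θ) ^ 2)⁻¹ * f (z + circleMap 0 1 θ • e))) ?_ ?_ 0 (2 * π))
  · have hc := hf.continuous
    have h2 : Continuous (circleMap 0 1) := continuous_circleMap 0 1
    have h3 : ∀ θ : ℝ, circleMap 0 1 θ ^ 2 ≠ 0 := fun θ =>
      pow_ne_zero _ (circleMap_ne_center one_ne_zero)
    have h4 : Continuous fun θ : ℝ => (circleMap 0 1 θ ^ 2)⁻¹ := (h2.pow 2).inv₀ h3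
    have h5 : Continuous fun p : ℝ × (Fin n → ℂ) => (circleMap 0 1 p.1 ^ 2)⁻¹ :=
      h4.comp continuous_fst
    have h6 : Continuous fun p : ℝ × (Fin n → ℂ) => f (p.2 + circleMap 0 1 p.1 • e) := by fun_prop
    have h7 : Continuous fun p : ℝ × (Fin n → ℂ) => circleMap 0 1 p.1 * I := by fun_prop
    exact h7.mul (h5.mul h6)
  · intro t
    fun_prop

lemma aux_hadamard {n : ℕ} {f : (Fin n → ℂ) → ℂ} (hf : Differentiable ℂ f) (j : Fin n) (a : ℂ)
    (h0 : ∀ z, z j = a → f z = 0) :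
    ∃ h : (Fin n → ℂ) → ℂ, Differentiable ℂ h ∧ ∀ z, f z = (z j - a) * h z := by
  set e : Fin n → ℂ := Pi.single j 1 with he
  have hF := aux_deriv hf e
  have hFc := hF.continuous
  refine ⟨fun z => ∫ t in (0:ℝ)..1,
    fderiv ℂ f (z + (((t:ℂ) - 1) * (z j - a)) • e) e, aux_param _ ?_ ?_ _ _, ?_⟩
  · exact hFc.comp (f := fun p : ℝ × (Fin n → ℂ) =>
      (p.2 + (((p.1:ℂ) - 1) * (p.2 j - a)) • e)) (by fun_prop)
  · intro t
    exact hF.comp (f := fun z : Fin n → ℂ => z + (((t:ℂ) - 1) * (z j - a)) • e) (by fun_prop)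
  · intro z
    have hd : ∀ t : ℝ, HasDerivAt (fun t : ℝ => f (z + (((t:ℂ) - 1) * (z j - a)) • e))
        ((z j - a) * fderiv ℂ f (z + (((t:ℂ) - 1) * (z j - a)) • e) e) t := by
      intro t
      have h1 : HasDerivAt (fun t : ℝ => ((t:ℂ) - 1) * (z j - a)) (z j - a) t := by
        simpa using (((hasDerivAt_id t).ofReal_comp).sub_const 1).mul_const (z j - a)
      have := (aux_line hf z e (((t:ℂ) - 1) * (z j - a))).comp t h1
      rw [mul_comm] at this
      exact this
    have := intervalIntegral.integral_eq_sub_of_hasDerivAt (a := 0) (b := 1)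
      (fun t _ => hd t) (Continuous.intervalIntegrable (continuous_const.mul
        (hFc.comp (f := fun t : ℝ => (z + (((t:ℂ) - 1) * (z j - a)) • e)) (by fun_prop))) _ _)
    rw [intervalIntegral.integral_const_mul] at this
    rw [this, h0 (z + ((((0:ℝ):ℂ) - 1) * (z j - a)) • e) (by simp [he])]
    simp

lemma aux_div {n : ℕ} {f : (Fin n → ℂ) → ℂ} (hf : Differentiable ℂ f) (j : Fin n)
    {S : ℂ → ℂ} (hS : Differentiable ℂ S) (hS' : ∀ a, S a = 0 → deriv S a ≠ 0)
    (h0 : ∀ z, S (z j) = 0 → f z = 0) :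
    ∃ g : (Fin n → ℂ) → ℂ, Differentiable ℂ g ∧ ∀ z, f z = S (z j) * g z := by
  have H : ∀ a, ∃ h : (Fin n → ℂ) → ℂ, S a = 0 → Differentiable ℂ h ∧ ∀ z, f z = (z j - a) * h z := by
    intro a
    by_cases ha : S a = 0
    · obtain ⟨h, hh⟩ := aux_hadamard hf j a (fun z hz => h0 z (by rw [hz, ha]))
      exact ⟨h, fun _ => hh⟩
    · exact ⟨0, fun h => absurd h ha⟩
  choose h hh using H
  classical
  refine ⟨fun z => if S (z j) = 0 then h (z j) z / deriv S (z j) else f z / S (z j), ?_, ?_⟩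
  · intro z0
    have hSj : Differentiable ℂ fun z : Fin n → ℂ => S (z j) :=
      hS.comp (by fun_prop : Differentiable ℂ fun z : Fin n → ℂ => z j)
    by_cases hz : S (z0 j) = 0
    · set a := z0 j with ha
      have hD : Differentiable ℂ (dslope S a) := by
        rw [← differentiableOn_univ, Complex.differentiableOn_dslope Filter.univ_mem]
        exact hS.differentiableOn
      have hDj : Differentiable ℂ fun z : Fin n → ℂ => dslope S a (z j) :=
        hD.comp (by fun_prop : Differentiable ℂ fun z : Fin n → ℂ => z j)
      have hne : dslope S a (z0 j) ≠ 0 := by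
        rw [← ha, dslope_same]; exact hS' a hz
      refine (((hh a hz).1 z0).mul ((hDj z0).inv hne)).congr_of_eventuallyEq ?_
      filter_upwards [hDj.continuous.continuousAt.eventually_ne hne] with z hzz
      have h1 := sub_smul_dslope S a (z j)
      rw [hz, sub_zero, smul_eq_mul] at h1
      by_cases hza : z j = a
      · simp [hza, hz, dslope_same, div_eq_mul_inv]
      · have h2 : z j - a ≠ 0 := sub_ne_zero.mpr hza
        have h3 : S (z j) ≠ 0 := by rw [← h1]; exact mul_ne_zero h2 hzz
        simp only [h3, if_false, Pi.mul_apply, Pi.inv_apply]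
        rw [← div_eq_mul_inv, (hh a hz).2 z, ← h1, mul_div_mul_left _ _ h2]
    · refine ((hf z0).mul ((hSj z0).inv hz)).congr_of_eventuallyEq ?_
      filter_upwards [hSj.continuous.continuousAt.eventually_ne hz] with z hzz
      simp [hzz, div_eq_mul_inv]
  · intro z
    by_cases hz : S (z j) = 0
    · simp [hz, h0 z hz]
    · simp only [hz, if_false]
      field_simp

lemma aux_cancel {n : ℕ} {g : (Fin n → ℂ) → ℂ} (hg : Continuous g) {j k : Fin n} (hjk : k ≠ j)
    {S : ℂ → ℂ} (hS : Differentiable ℂ S) (hS' : ∀ a, S a = 0 → deriv S a ≠ 0) (c : ℂ)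
    (h0 : ∀ z, z k = c → S (z j) * g z = 0) (z : Fin n → ℂ) (hz : z k = c) : g z = 0 := by
  by_cases hj : S (z j) = 0
  · have hc : Continuous fun w : ℂ => g (Function.update z j w) :=
      hg.comp (continuous_const.update j continuous_id)
    have h1 : Filter.Tendsto (fun w : ℂ => g (Function.update z j w))
        (nhdsWithin (z j) {z j}ᶜ) (nhds (g z)) := by
      have := hc.tendsto (z j)
      simp only [Function.update_eq_self] at this
      exact this.mono_left nhdsWithin_le_nhds
    have h2 := (hS (z j)).hasDerivAt.eventually_ne (c := 0) (hS' _ hj)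
    refine tendsto_nhds_unique (h1.congr' ?_) tendsto_const_nhds
    filter_upwards [h2] with w hw
    have := h0 (Function.update z j w) (by rw [Function.update_of_ne hjk, hz])
    rw [Function.update_self] at this
    exact (mul_eq_zero.mp this).resolve_left hw
  · exact (mul_eq_zero.mp (h0 z hz)).resolve_left hj

/-- **Lemma 2.1**: if an entire function `f : ℂⁿ → ℂ` vanishes on
`Hⁿ = {z : some coordinate of z is an even integer}`, then `f` is divisible by
`sic_n(πz) = ∏_j sin (π z_j / 2)` in the ring of entire functions. -/
theorem divisible_by_sic_of_vanishing_on_H {n : ℕ}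
    (f : (Fin n → ℂ) → ℂ) (hf : Differentiable ℂ f)
    (hvanish : ∀ z : Fin n → ℂ, (∃ j : Fin n, ∃ m : ℤ, z j = 2 * m) → f z = 0) :
    ∃ g : (Fin n → ℂ) → ℂ, Differentiable ℂ g ∧
      ∀ z : Fin n → ℂ, f z = (∏ j, Complex.sin (Real.pi * z j / 2)) * g z := by
  have hpi : (π : ℂ) ≠ 0 := by exact_mod_cast Real.pi_ne_zero
  let S : ℂ → ℂ := fun w => Complex.sin (Real.pi * w / 2)
  have hSd : ∀ w, HasDerivAt S (Complex.cos (Real.pi * w / 2) * (π / 2)) w := by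
    intro w
    have h1 : HasDerivAt (fun w : ℂ => (π : ℂ) * w / 2) (π / 2) w := by
      simpa using ((hasDerivAt_id w).const_mul (π : ℂ)).div_const 2
    exact h1.csin
  have hS : Differentiable ℂ S := fun w => (hSd w).differentiableAt
  have hS' : ∀ a, S a = 0 → deriv S a ≠ 0 := by
    intro a ha
    rw [(hSd a).deriv]
    refine mul_ne_zero (fun hc => ?_) (by simp)
    have := Complex.sin_sq_add_cos_sq (Real.pi * a / 2)
    simp only [S] at ha
    rw [ha, hc] at this
    norm_num at this
  have hS0 : ∀ w, S w = 0 → ∃ m : ℤ, w = 2 * m := by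
    intro w hw
    obtain ⟨k, hk⟩ := Complex.sin_eq_zero_iff.mp hw
    refine ⟨k, ?_⟩
    field_simp at hk
    rw [hk]
  have main : ∀ s : Finset (Fin n), ∃ g : (Fin n → ℂ) → ℂ, Differentiable ℂ g ∧
      (∀ z, f z = (∏ j ∈ s, S (z j)) * g z) ∧
      ∀ k ∉ s, ∀ m : ℤ, ∀ z : Fin n → ℂ, z k = 2 * m → g z = 0 := by
    classical
    intro s
    induction s using Finset.induction_on with
    | empty => exact ⟨f, hf, by simp, fun k _ m z hz => hvanish z ⟨k, m, hz⟩⟩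
    | insert j s hj ih =>
      obtain ⟨g, hg, hfg, hg0⟩ := ih
      obtain ⟨g', hg', hgg⟩ := aux_div hg j hS hS' (fun z hz => by
        obtain ⟨m, hm⟩ := hS0 _ hz
        exact hg0 j hj m z hm)
      refine ⟨g', hg', fun z => ?_, fun k hk m z hz => ?_⟩
      · rw [hfg z, hgg z, Finset.prod_insert hj]; ring
      · rw [Finset.mem_insert, not_or] at hk
        refine aux_cancel hg'.continuous hk.1 hS hS' (2 * m) (fun y hy => ?_) z hz
        rw [← hgg y]
        exact hg0 k hk.2 m y hy
  obtain ⟨g, hg, hfg, -⟩ := main Finset.univ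
  exact ⟨g, hg, hfg⟩
end

section
/- Let f : ℂⁿ → ℂ be an entire function of exponential type (π,…,π) whose restriction to ℝⁿ is continuous and vanishes at infinity. If (∂^k f)(u) = 0 for every k ∈ Eⁿ and every u ∈ 2ℤⁿ, then f is identically zero. -/
open Complex Real Filter

/-- Partial derivative of `f : ℂⁿ → ℂ` in the `j`-th coordinate direction. -/
noncomputable def pderivC {n : ℕ} (j : Fin n) (f : (Fin n → ℂ) → ℂ) : (Fin n → ℂ) → ℂ :=
  fun z => fderiv ℂ f z (Pi.single j 1)

/-- Mixed partial derivative `∂^k f` for a multi-index `k`. -/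
noncomputable def mixedPartial {n : ℕ} (k : Fin n → ℕ) (f : (Fin n → ℂ) → ℂ) :
    (Fin n → ℂ) → ℂ :=
  (List.finRange n).foldr (fun j g => (pderivC j)^[k j] g) f


lemma div_entire (g s : ℂ → ℂ) (hg : Differentiable ℂ g) (hs : Differentiable ℂ s)
    (h0 : ∀ z, s z = 0 → g z = 0) (h1 : ∀ z, s z = 0 → deriv s z ≠ 0) :
    ∃ h : ℂ → ℂ, Differentiable ℂ h ∧ ∀ z, g z = s z * h z := by
  classical
  refine ⟨fun z => if s z = 0 then deriv g z / deriv s z else g z / s z, ?_, ?_⟩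
  · intro z0
    by_cases hz : s z0 = 0
    · have dg : Differentiable ℂ (dslope g z0) := by
        rw [← differentiableOn_univ]
        exact (Complex.differentiableOn_dslope univ_mem).2 hg.differentiableOn
      have ds : Differentiable ℂ (dslope s z0) := by
        rw [← differentiableOn_univ]
        exact (Complex.differentiableOn_dslope univ_mem).2 hs.differentiableOn
      have hne : dslope s z0 z0 ≠ 0 := by rw [dslope_same]; exact h1 z0 hz
      have hev : ∀ᶠ z in nhds z0, dslope s z0 z ≠ 0 :=
        ds.continuous.continuousAt.eventually_ne hne
      have hd : DifferentiableAt ℂ (fun z => dslope g z0 z / dslope s z0 z) z0 :=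
        (dg z0).div (ds z0) hne
      refine hd.congr_of_eventuallyEq ?_
      filter_upwards [hev] with z hz'
      by_cases hzz : z = z0
      · subst hzz; simp [hz, dslope_same]
      · have e1 : (z - z0) * dslope s z0 z = s z := by
          have := sub_smul_dslope s z0 z
          simpa [hz] using this
        have e2 : (z - z0) * dslope g z0 z = g z := by
          have := sub_smul_dslope g z0 z
          simpa [h0 z0 hz] using this
        have hzs : z - z0 ≠ 0 := sub_ne_zero.2 hzz
        have : s z ≠ 0 := by rw [← e1]; exact mul_ne_zero hzs hz'
        simp only [this, if_false]
        rw [← e1, ← e2]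
        field_simp
    · have hev : ∀ᶠ z in nhds z0, s z ≠ 0 := hs.continuous.continuousAt.eventually_ne hz
      refine ((hg z0).div (hs z0) hz).congr_of_eventuallyEq ?_
      filter_upwards [hev] with z hz'
      simp [hz']
  · intro z
    by_cases hz : s z = 0
    · simp [hz, h0 z hz]
    · simp only [hz, if_false]; field_simp

lemma sin_lower (z : ℂ) : (Real.exp |z.im| - Real.exp (-|z.im|)) / 2 ≤ ‖Complex.sin z‖ := by
  have h : ‖Complex.sin z‖ = ‖Complex.exp (-z * I) - Complex.exp (z * I)‖ / 2 := by
    rw [Complex.sin]; simp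
  have a1 : ‖Complex.exp (-z * I)‖ = Real.exp z.im := by rw [Complex.norm_exp]; simp
  have a2 : ‖Complex.exp (z * I)‖ = Real.exp (-z.im) := by rw [Complex.norm_exp]; simp
  have h1 := norm_sub_norm_le (Complex.exp (-z * I)) (Complex.exp (z * I))
  have h2 := norm_sub_norm_le (Complex.exp (z * I)) (Complex.exp (-z * I))
  rw [norm_sub_rev] at h2
  rw [a1, a2] at h1 h2
  rw [h]
  rcases abs_cases z.im with ⟨e, _⟩ | ⟨e, _⟩ <;> rw [e]
  · linarith
  · rw [neg_neg]; linarith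

lemma sin_lower' (z : ℂ) (hz : 1 ≤ |z.im|) :
    Real.exp (Real.pi * |z.im|) / 16 ≤ ‖Complex.sin (Real.pi / 2 * z)‖ ^ 2 := by
  have h := sin_lower (Real.pi / 2 * z)
  have him : ((Real.pi : ℂ) / 2 * z).im = Real.pi / 2 * z.im := by
    have : ((Real.pi : ℂ) / 2) = ((Real.pi / 2 : ℝ) : ℂ) := by push_cast; rfl
    rw [this, Complex.im_ofReal_mul]
  rw [him, abs_mul, abs_of_pos (by positivity : (0:ℝ) < Real.pi / 2)] at h
  set y := Real.pi / 2 * |z.im| with hy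
  have hy1 : 1 ≤ y := by nlinarith [Real.pi_gt_three]
  have e2 : Real.exp (Real.pi * |z.im|) = Real.exp y ^ 2 := by
    rw [← Real.exp_nat_mul]; congr 1; push_cast; rw [hy]; ring
  have h2 : 2 ≤ Real.exp y := by linarith [Real.add_one_le_exp y]
  have h3 : Real.exp (-y) ≤ 1 := Real.exp_le_one_iff.2 (by linarith)
  rw [e2]
  have : Real.exp y / 4 ≤ ‖Complex.sin (Real.pi / 2 * z)‖ := by linarith
  nlinarith

lemma oneD (g : ℂ → ℂ) (hg : Differentiable ℂ g) (C : ℝ)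
    (hC : ∀ z, ‖g z‖ ≤ C * Real.exp (Real.pi * |z.im|))
    (h0 : ∀ m : ℤ, g (2 * m) = 0) (h1 : ∀ m : ℤ, deriv g (2 * m) = 0)
    (hlim : Tendsto (fun m : ℕ => g (2 * m + 1)) atTop (nhds 0)) : g = 0 := by
  set s : ℂ → ℂ := fun z => Complex.sin (Real.pi / 2 * z) with hs
  have hpi : (Real.pi : ℂ) ≠ 0 := by exact_mod_cast Real.pi_ne_zero
  have sder : ∀ z, HasDerivAt s (Complex.cos (Real.pi / 2 * z) * (Real.pi / 2)) z := by
    intro z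
    have : HasDerivAt (fun z : ℂ => (Real.pi / 2 : ℂ) * z) (Real.pi / 2) z := by
      simpa using (hasDerivAt_id z).const_mul (Real.pi / 2 : ℂ)
    exact this.csin
  have sd : Differentiable ℂ s := fun z => (sder z).differentiableAt
  have sz : ∀ z, s z = 0 → ∃ m : ℤ, z = 2 * m := by
    intro z hz
    obtain ⟨k, hk⟩ := Complex.sin_eq_zero_iff.1 hz
    refine ⟨k, ?_⟩
    field_simp at hk
    linear_combination hk
  have sz' : ∀ z, s z = 0 → deriv s z ≠ 0 := by
    intro z hz
    rw [(sder z).deriv]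
    refine mul_ne_zero ?_ (by simp)
    intro hc
    have := Complex.sin_sq_add_cos_sq (Real.pi / 2 * z)
    rw [hc, show Complex.sin (Real.pi / 2 * z) = 0 from hz] at this
    simp at this
  obtain ⟨a, ad, ha⟩ := div_entire g s hg sd
    (fun z hz => by obtain ⟨m, rfl⟩ := sz z hz; exact h0 m) sz'
  have a0 : ∀ z, s z = 0 → a z = 0 := by
    intro z hz
    have e : g = fun z => s z * a z := funext ha
    have d := ((sd z).hasDerivAt.mul (ad z).hasDerivAt).deriv
    have d2 : deriv g z = 0 := by obtain ⟨m, rfl⟩ := sz z hz; exact h1 m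
    have d3 : deriv g z = deriv s z * a z + s z * deriv a z := by rw [← d]; rw [e]; rfl
    rw [d2, hz] at d3
    simp only [zero_mul, add_zero] at d3
    exact (mul_eq_zero.1 d3.symm).resolve_left (sz' z hz)
  obtain ⟨h, hd, hh⟩ := div_entire a s ad sd a0 sz'
  have key : ∀ z, ‖s z‖ ^ 2 * ‖h z‖ ≤ C * Real.exp (Real.pi * |z.im|) := by
    intro z
    refine le_trans (le_of_eq ?_) (hC z)
    rw [ha, hh, norm_mul, norm_mul]; ring
  have C0 : 0 ≤ C := by
    have := (norm_nonneg _).trans (hC 0)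
    simpa using this
  obtain ⟨r0, hr0, hmin⟩ := (isCompact_sphere (0:ℂ) (3/2)).exists_isMinOn
    (NormedSpace.sphere_nonempty.2 (by norm_num)) (f := fun z => ‖s z‖)
    sd.continuous.norm.continuousOn
  have δpos : 0 < ‖s r0‖ := by
    rw [norm_pos_iff]
    intro hz
    obtain ⟨m, hm⟩ := sz _ hz
    rw [hm] at hr0
    simp at hr0
    have h4 : |(m:ℝ)| * 4 = 3 := by linarith
    have : |m| * 4 = 3 := by exact_mod_cast h4
    omega
  have sper : ∀ (m : ℤ) (z : ℂ), ‖s (2 * m + z)‖ = ‖s z‖ := by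
    intro m z
    have : (Real.pi / 2 : ℂ) * (2 * m + z) = Real.pi / 2 * z + m * Real.pi := by ring
    simp only [hs]
    rw [this, Complex.sin_antiperiodic.add_int_mul_eq, Int.cast_negOnePow, norm_mul]
    simp
  set M := C * Real.exp (Real.pi * (3/2)) / ‖s r0‖ ^ 2 with hM
  have hball : ∀ (m : ℤ) (z : ℂ), z ∈ Metric.closedBall (2 * m : ℂ) (3/2) → ‖h z‖ ≤ M := by
    intro m z hz
    refine Complex.norm_le_of_forall_mem_frontier_norm_le (U := Metric.ball (2 * m : ℂ) (3/2))
      Metric.isBounded_ball hd.diffContOnCl ?_ ?_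
    · intro w hw
      rw [frontier_ball _ (by norm_num)] at hw
      have hw' : w - 2 * m ∈ Metric.sphere (0:ℂ) (3/2) := by
        simpa [dist_eq_norm] using hw
      have h1 : ‖s r0‖ ≤ ‖s w‖ := by
        have := hmin hw'
        have e := sper m (w - 2 * m)
        rw [add_sub_cancel] at e
        rw [e]; exact this
      have h2 : |w.im| ≤ 3/2 := by
        have := Complex.abs_im_le_norm (w - 2 * m)
        simp at hw'
        rw [hw'] at this
        simpa using this
      rw [hM, le_div_iff₀ (by positivity)]
      calc ‖h w‖ * ‖s r0‖ ^ 2 ≤ ‖h w‖ * ‖s w‖ ^ 2 := by gcongr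
        _ ≤ C * Real.exp (Real.pi * |w.im|) := by rw [mul_comm]; exact key w
        _ ≤ _ := by gcongr
    · rw [closure_ball _ (by norm_num)]; exact hz
  have hbd : ∀ z, ‖h z‖ ≤ max M (16 * C) := by
    intro z
    by_cases hz : 1 ≤ |z.im|
    · refine le_max_of_le_right ?_
      have h1 := sin_lower' z hz
      have h2 := key z
      have hp := Real.exp_pos (Real.pi * |z.im|)
      have h3 : Real.exp (Real.pi * |z.im|) / 16 * ‖h z‖ ≤ C * Real.exp (Real.pi * |z.im|) :=
        (mul_le_mul_of_nonneg_right h1 (norm_nonneg _)).trans h2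
      have h4 : Real.exp (Real.pi * |z.im|) * ‖h z‖ ≤ Real.exp (Real.pi * |z.im|) * (16 * C) := by
        linarith
      exact le_of_mul_le_mul_left h4 hp
    · refine le_max_of_le_left (hball (round (z.re / 2)) z ?_)
      have h1 := abs_sub_round (z.re / 2)
      push Not at hz
      rw [Metric.mem_closedBall, dist_eq_norm]
      have hre : |z.re - 2 * (round (z.re / 2) : ℝ)| ≤ 1 := by
        rw [abs_le] at h1 ⊢; constructor <;> linarith [h1.1, h1.2]
      rw [← abs_of_nonneg (norm_nonneg _), ← abs_of_pos (by norm_num : (0:ℝ) < 3/2), ← sq_le_sq,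
        Complex.sq_norm, Complex.normSq_apply]
      simp
      rw [abs_le] at hre
      rw [abs_lt] at hz
      nlinarith [hre.1, hre.2, hz.1, hz.2]
  obtain ⟨c, hc⟩ := hd.exists_const_forall_eq_of_bounded
    ((Metric.isBounded_closedBall (x := (0:ℂ)) (r := max M (16 * C))).subset (by
      rintro _ ⟨z, rfl⟩; simpa using hbd z))
  have hodd : ∀ m : ℕ, ‖g (2 * m + 1)‖ = ‖c‖ := by
    intro m
    have : ‖s (2 * m + 1)‖ = 1 := by
      have := sper m 1
      push_cast at this
      rw [this]; simp [hs]
    rw [ha, hh, hc, norm_mul, norm_mul, this]; ring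
  have c0 : c = 0 := by
    have := hlim.norm
    simp only [hodd, norm_zero] at this
    exact norm_eq_zero.1 (tendsto_nhds_unique tendsto_const_nhds this)
  funext z
  rw [ha, hh, hc, c0]; simp

lemma slice_hasDerivAt {n : ℕ} (f : (Fin n → ℂ) → ℂ) (hf : Differentiable ℂ f) (j : Fin n)
    (z : Fin n → ℂ) (w : ℂ) :
    HasDerivAt (fun w : ℂ => f (z + w • Pi.single j 1))
      (pderivC j f (z + w • Pi.single j 1)) w := by
  have h1 : HasDerivAt (fun w : ℂ => z + w • (Pi.single j 1 : Fin n → ℂ)) (Pi.single j 1) w := by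
    simpa using ((hasDerivAt_id w).smul_const (Pi.single j 1 : Fin n → ℂ)).const_add z
  exact (hf _).hasFDerivAt.comp_hasDerivAt w h1

lemma pderivC_differentiable {n : ℕ} (f : (Fin n → ℂ) → ℂ) (hf : Differentiable ℂ f) (j : Fin n) :
    Differentiable ℂ (pderivC j f) := by
  set e : Fin n → ℂ := Pi.single j 1 with he
  have hen : ‖e‖ ≤ 1 := by rw [he, Pi.norm_single]; simp
  set a : ℝ → ℂ := fun θ => deriv (circleMap 0 1) θ * (1 / (circleMap 0 1 θ - 0) ^ 2) with ha
  have hcm : ∀ θ, ‖circleMap 0 1 θ‖ = 1 := fun θ => by simp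
  have hacont : Continuous a := by
    simp only [ha, deriv_circleMap]
    refine Continuous.mul (by fun_prop) (Continuous.div (by fun_prop) (by fun_prop) ?_)
    intro θ
    have : circleMap 0 1 θ ≠ 0 := by rw [← norm_ne_zero_iff, hcm]; norm_num
    simpa using this
  have hform : pderivC j f = fun z => (2 * Real.pi * Complex.I)⁻¹ *
      ∫ θ in (0:ℝ)..2 * Real.pi, a θ * f (z + circleMap 0 1 θ • e) := by
    funext z
    have hd : Differentiable ℂ (fun w : ℂ => f (z + w • e)) :=
      fun w => (slice_hasDerivAt f hf j z w).differentiableAt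
    have := hd.differentiableOn.deriv_eq_smul_circleIntegral (c := 0) (R := 1) one_pos
    rw [(slice_hasDerivAt f hf j z 0).deriv] at this
    simp only [zero_smul, add_zero, smul_eq_mul] at this
    rw [eq_comm, inv_mul_eq_iff_eq_mul₀ (by simp [Real.pi_ne_zero]), ← this, circleIntegral]
    simp only [smul_eq_mul, ha, mul_assoc]
  rw [hform]
  intro z0
  refine DifferentiableAt.const_mul ?_ _
  obtain ⟨K, hK⟩ := (isCompact_closedBall z0 3).exists_bound_of_continuousOn
    hf.continuous.continuousOn
  have hfd : ∀ p ∈ Metric.closedBall z0 2, ‖fderiv ℂ f p‖ ≤ 2 * K := by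
    intro p hp
    have := Complex.norm_fderiv_le_div_of_mapsTo_ball (f := f) (c := p) (R₁ := 1) (R₂ := 2 * K)
      hf.differentiableOn ?_ one_pos
    · simpa using this
    · intro q hq
      rw [Metric.mem_closedBall] at *
      rw [Metric.mem_ball] at hq
      have h1 := hK q (by
        rw [Metric.mem_closedBall]; linarith [dist_triangle q p z0])
      have h2 := hK p (by rw [Metric.mem_closedBall]; linarith)
      rw [dist_eq_norm]
      linarith [norm_sub_le (f q) (f p)]
  have hcont : ∀ z, Continuous fun θ => a θ * f (z + circleMap 0 1 θ • e) := by
    intro z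
    refine hacont.mul (hf.continuous.comp ?_)
    fun_prop
  refine (intervalIntegral.hasFDerivAt_integral_of_dominated_of_fderiv_le (𝕜 := ℂ)
    (F := fun z θ => a θ * f (z + circleMap 0 1 θ • e))
    (F' := fun z θ => a θ • fderiv ℂ f (z + circleMap 0 1 θ • e))
    (bound := fun θ => ‖a θ‖ * (2 * K)) (Metric.ball_mem_nhds z0 one_pos) ?_ ?_ ?_ ?_ ?_ ?_
    ).differentiableAt
  · exact Eventually.of_forall fun z => (hcont z).aestronglyMeasurable
  · exact (hcont z0).intervalIntegrable _ _
  · have hm : Measurable fun θ : ℝ => fderiv ℂ f (z0 + circleMap 0 1 θ • e) := by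
      refine (measurable_fderiv ℂ f).comp (Continuous.measurable ?_)
      fun_prop
    exact (hacont.measurable.smul hm).aestronglyMeasurable
  · refine Eventually.of_forall fun θ _ z hz => ?_
    rw [norm_smul]
    refine mul_le_mul_of_nonneg_left (hfd _ ?_) (norm_nonneg _)
    rw [Metric.mem_closedBall, dist_eq_norm]
    rw [Metric.mem_ball, dist_eq_norm] at hz
    calc ‖z + circleMap 0 1 θ • e - z0‖ = ‖(z - z0) + circleMap 0 1 θ • e‖ := by congr 1; abel
      _ ≤ ‖z - z0‖ + ‖circleMap 0 1 θ • e‖ := norm_add_le _ _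
      _ ≤ 1 + 1 := by
        rw [norm_smul, hcm]; linarith
      _ = 2 := by norm_num
  · exact (hacont.norm.mul continuous_const).intervalIntegrable _ _
  · refine Eventually.of_forall fun θ _ z hz => ?_
    have h1 : HasFDerivAt (fun z => f (z + circleMap 0 1 θ • e))
        (fderiv ℂ f (z + circleMap 0 1 θ • e)) z := by
      rw [hasFDerivAt_comp_add_right]
      exact (hf _).hasFDerivAt
    exact h1.const_mul (a θ)

lemma im_sum_le {n : ℕ} (j : Fin n) (z : Fin n → ℂ) (w : ℂ) :
    ∑ i, |((z + w • (Pi.single j 1 : Fin n → ℂ)) i).im| ≤ (∑ i, |(z i).im|) + |w.im| := by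
  have : (∑ i, |(z i).im|) + |w.im| = ∑ i, (|(z i).im| + if i = j then |w.im| else 0) := by
    rw [Finset.sum_add_distrib]; simp
  rw [this]
  refine Finset.sum_le_sum fun i _ => ?_
  by_cases h : i = j
  · subst h; simpa using abs_add_le _ _
  · simp [h]

lemma taylor_bound (φ φ' φ'' : ℝ → ℂ) (h1 : ∀ t, HasDerivAt φ (φ' t) t)
    (h2 : ∀ t, HasDerivAt φ' (φ'' t) t) (M : ℝ) (hM : ∀ t, ‖φ'' t‖ ≤ M) (h : ℝ) (hh : 0 < h) :
    ‖φ' 0‖ ≤ (‖φ h‖ + ‖φ 0‖) / h + M * h := by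
  have M0 : 0 ≤ M := (norm_nonneg _).trans (hM 0)
  have b1 : ∀ t ∈ Set.Icc 0 h, ‖φ' t - φ' 0‖ ≤ M * h := by
    intro t ht
    have := Convex.norm_image_sub_le_of_norm_hasDerivWithin_le (f := φ') (f' := φ'')
      (s := Set.univ) (C := M) (x := 0) (y := t)
      (fun x _ => (h2 x).hasDerivWithinAt) (fun x _ => hM x) convex_univ trivial trivial
    refine this.trans (mul_le_mul_of_nonneg_left ?_ M0)
    rw [sub_zero, Real.norm_eq_abs, abs_of_nonneg ht.1]; exact ht.2
  have d2 : ∀ t, HasDerivAt (fun t : ℝ => φ t - t * φ' 0) (φ' t - φ' 0) t := by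
    intro t
    have := (Complex.ofRealCLM.hasDerivAt (x := t)).mul_const (φ' 0)
    have h3 := (h1 t).sub this
    simp only [Complex.ofRealCLM_apply, Complex.ofReal_one, one_mul] at h3
    exact h3
  have b2 := Convex.norm_image_sub_le_of_norm_hasDerivWithin_le
      (f := fun t : ℝ => φ t - t * φ' 0) (f' := fun t => φ' t - φ' 0)
      (s := Set.Icc 0 h) (C := M * h) (x := 0) (y := h)
      (fun x _ => (d2 x).hasDerivWithinAt) b1 (convex_Icc _ _) ⟨le_rfl, hh.le⟩ ⟨hh.le, le_rfl⟩
  simp only [sub_zero, Real.norm_eq_abs, abs_of_pos hh, Complex.ofReal_zero, zero_mul] at b2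
  have b3 : ‖(h : ℂ) * φ' 0‖ ≤ ‖φ h‖ + ‖φ 0‖ + M * h * h := by
    have : (h : ℂ) * φ' 0 = φ h - φ 0 - (φ h - h * φ' 0 - φ 0) := by ring
    rw [this]
    refine (norm_sub_le _ _).trans ?_
    linarith [norm_sub_le (φ h) (φ 0)]
  rw [norm_mul, Complex.norm_real, Real.norm_eq_abs, abs_of_pos hh] at b3
  have : (‖φ h‖ + ‖φ 0‖) / h + M * h = (‖φ h‖ + ‖φ 0‖ + M * h * h) / h := by field_simp
  rw [this, le_div_iff₀ hh]; linarith

structure PW {n : ℕ} (f : (Fin n → ℂ) → ℂ) : Prop where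
  diff : Differentiable ℂ f
  bound : ∃ C : ℝ, ∀ z, ‖f z‖ ≤ C * Real.exp (Real.pi * ∑ j, |(z j).im|)
  zero : Tendsto (fun x : Fin n → ℝ => f (fun j => (x j : ℂ))) (cocompact (Fin n → ℝ)) (nhds 0)

lemma pderivC_bound {n : ℕ} (f : (Fin n → ℂ) → ℂ) (hf : Differentiable ℂ f) (j : Fin n)
    (hb : ∃ C : ℝ, ∀ z, ‖f z‖ ≤ C * Real.exp (Real.pi * ∑ j, |(z j).im|)) :
    ∃ C : ℝ, ∀ z, ‖pderivC j f z‖ ≤ C * Real.exp (Real.pi * ∑ j, |(z j).im|) := by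
  obtain ⟨C, hC⟩ := hb
  have C0 : 0 ≤ C := by
    have := (norm_nonneg _).trans (hC 0)
    simpa using this
  refine ⟨C * Real.exp Real.pi, fun z => ?_⟩
  have hd : Differentiable ℂ (fun w : ℂ => f (z + w • Pi.single j 1)) :=
    fun w => (slice_hasDerivAt f hf j z w).differentiableAt
  have := Complex.norm_deriv_le_of_forall_mem_sphere_norm_le (c := 0) (R := 1)
    (C := C * Real.exp Real.pi * Real.exp (Real.pi * ∑ j, |(z j).im|)) one_pos
    hd.diffContOnCl ?_
  · rw [(slice_hasDerivAt f hf j z 0).deriv] at this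
    simpa using this
  · intro w hw
    refine (hC _).trans ?_
    rw [mul_assoc, ← Real.exp_add]
    refine mul_le_mul_of_nonneg_left (Real.exp_le_exp.2 ?_) C0
    have h1 := im_sum_le j z w
    have h2 : |w.im| ≤ 1 := by
      have := Complex.abs_im_le_norm w
      simp at hw
      rwa [hw] at this
    have := Real.pi_pos
    nlinarith

lemma PW.pderiv {n : ℕ} {f : (Fin n → ℂ) → ℂ} (hf : PW f) (j : Fin n) : PW (pderivC j f) := by
  have hd := pderivC_differentiable f hf.diff j
  have hb := pderivC_bound f hf.diff j hf.bound
  refine ⟨hd, hb, ?_⟩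
  obtain ⟨M, hM⟩ := pderivC_bound _ hd j hb
  have M0 : 0 ≤ M := by
    have := (norm_nonneg _).trans (hM 0)
    simpa using this
  have hreal : ∀ (x : Fin n → ℝ) (t : ℝ), (fun i => (x i : ℂ)) + (t : ℂ) • (Pi.single j 1 : Fin n → ℂ)
      = fun i => (((x + t • (Pi.single j 1 : Fin n → ℝ)) i : ℝ) : ℂ) := by
    intro x t
    funext i
    by_cases h : i = j
    · subst h; simp
    · simp [h]
  have key : ∀ (x : Fin n → ℝ) (h : ℝ), 0 < h →
      ‖pderivC j f (fun i => (x i : ℂ))‖ ≤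
        (‖f (fun i => (((x + h • (Pi.single j 1 : Fin n → ℝ)) i : ℝ) : ℂ))‖
          + ‖f (fun i => (x i : ℂ))‖) / h + M * h := by
    intro x h hh
    have := taylor_bound
      (fun t : ℝ => f ((fun i => (x i : ℂ)) + (t : ℂ) • Pi.single j 1))
      (fun t : ℝ => pderivC j f ((fun i => (x i : ℂ)) + (t : ℂ) • Pi.single j 1))
      (fun t : ℝ => pderivC j (pderivC j f) ((fun i => (x i : ℂ)) + (t : ℂ) • Pi.single j 1))
      (fun t => (slice_hasDerivAt f hf.diff j _ t).comp_ofReal)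
      (fun t => (slice_hasDerivAt _ hd j _ t).comp_ofReal) M ?_ h hh
    · rw [← hreal]
      simpa using this
    · intro t
      refine (hM _).trans ?_
      rw [hreal]; simp
  rw [Metric.tendsto_nhds]
  intro ε hε
  set h := ε / (4 * (M + 1)) with hh
  have hpos : 0 < h := by positivity
  have hMh : M * h ≤ ε / 4 := by
    rw [hh, mul_div_assoc', div_le_div_iff₀ (by positivity) (by norm_num)]
    nlinarith
  have e1 := (Metric.tendsto_nhds.1 hf.zero) (ε * h / 8) (by positivity)
  have e2 := ((Homeomorph.addRight (h • (Pi.single j 1 : Fin n → ℝ))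
    ).isClosedEmbedding.tendsto_cocompact).eventually e1
  filter_upwards [e1, e2] with x h1 h2
  rw [dist_zero_right] at *
  have h2' : ‖f (fun i => (((x + h • (Pi.single j 1 : Fin n → ℝ)) i : ℝ) : ℂ))‖ < ε * h / 8 := h2
  have h3 : (‖f (fun i => (((x + h • (Pi.single j 1 : Fin n → ℝ)) i : ℝ) : ℂ))‖
          + ‖f (fun i => (x i : ℂ))‖) / h ≤ ε / 4 := by
    rw [div_le_iff₀ hpos]; linarith
  linarith [key x h hpos]

lemma PW.iter {n : ℕ} {f : (Fin n → ℂ) → ℂ} (hf : PW f) (j : Fin n) (m : ℕ) :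
    PW ((pderivC j)^[m] f) := by
  induction m with
  | zero => exact hf
  | succ m ih => rw [Function.iterate_succ_apply']; exact ih.pderiv j

lemma PW.fold {n : ℕ} {f : (Fin n → ℂ) → ℂ} (hf : PW f) (k : Fin n → ℕ) (L : List (Fin n)) :
    PW (L.foldr (fun j g => (pderivC j)^[k j] g) f) := by
  induction L with
  | nil => exact hf
  | cons j L ih => exact ih.iter j _

lemma update_eq {n : ℕ} (j : Fin n) (z : Fin n → ℂ) (w : ℂ) :
    Function.update z j w = Function.update z j 0 + w • (Pi.single j 1 : Fin n → ℂ) := by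
  funext i
  by_cases h : i = j
  · subst h; simp
  · simp [h]

lemma PW.line {n : ℕ} {g : (Fin n → ℂ) → ℂ} (hg : PW g) (j : Fin n) (y : Fin n → ℝ)
    (h0 : ∀ m : ℤ, g (fun i => ((Function.update y j (2 * m : ℝ) i : ℝ) : ℂ)) = 0)
    (h1 : ∀ m : ℤ, pderivC j g (fun i => ((Function.update y j (2 * m : ℝ) i : ℝ) : ℂ)) = 0) :
    g (fun i => (y i : ℂ)) = 0 := by
  have hup : ∀ t : ℝ, (fun i => ((Function.update y j t i : ℝ) : ℂ)) =
      Function.update (fun i => (y i : ℂ)) j 0 + (t : ℂ) • (Pi.single j 1 : Fin n → ℂ) := by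
    intro t
    rw [← update_eq]
    funext i
    by_cases h : i = j
    · subst h; simp
    · simp [h]
  set z : Fin n → ℂ := Function.update (fun i => (y i : ℂ)) j 0 with hz
  obtain ⟨C, hC⟩ := hg.bound
  have C0 : 0 ≤ C := by
    have := (norm_nonneg _).trans (hC 0)
    simpa using this
  have hzim : ∑ i, |(z i).im| = 0 := by
    refine Finset.sum_eq_zero fun i _ => ?_
    by_cases h : i = j
    · subst h; simp [hz]
    · simp [hz, h]
  have := oneD (fun w => g (z + w • Pi.single j 1))
    (fun w => (slice_hasDerivAt g hg.diff j z w).differentiableAt) C ?_ ?_ ?_ ?_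
  · have h2 := congrFun this (y j : ℂ)
    beta_reduce at h2
    rw [← hup, Function.update_eq_self] at h2
    exact h2
  · intro w
    refine (hC _).trans ?_
    refine mul_le_mul_of_nonneg_left (Real.exp_le_exp.2 ?_) C0
    refine mul_le_mul_of_nonneg_left ?_ Real.pi_pos.le
    have := im_sum_le j z w
    rwa [hzim, zero_add] at this
  · intro m
    have := h0 m
    rw [hup] at this
    simpa using this
  · intro m
    have := h1 m
    rw [hup] at this
    rw [(slice_hasDerivAt g hg.diff j z _).deriv]
    simpa using this
  · have ht : Tendsto (fun m : ℕ => Function.update y j (2 * m + 1 : ℝ)) atTop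
        (cocompact (Fin n → ℝ)) := by
      rw [← Metric.cobounded_eq_cocompact, ← tendsto_norm_atTop_iff_cobounded]
      refine tendsto_atTop_mono (f := fun m : ℕ => (m : ℝ)) ?_ tendsto_natCast_atTop_atTop
      intro m
      have := norm_le_pi_norm (Function.update y j (2 * m + 1 : ℝ)) j
      refine le_trans ?_ this
      rw [Function.update_self, Real.norm_eq_abs, abs_of_nonneg (by positivity)]
      have : (0:ℝ) ≤ m := by positivity
      linarith
    have := hg.zero.comp ht
    refine this.congr fun m => ?_
    simp only [Function.comp]
    rw [hup]
    push_cast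
    rfl

lemma fold_congr {n : ℕ} (f : (Fin n → ℂ) → ℂ) (k k' : Fin n → ℕ) (L : List (Fin n))
    (h : ∀ j ∈ L, k j = k' j) :
    L.foldr (fun j g => (pderivC j)^[k j] g) f = L.foldr (fun j g => (pderivC j)^[k' j] g) f := by
  induction L with
  | nil => rfl
  | cons j L ih =>
    simp only [List.foldr_cons]
    rw [ih (fun i hi => h i (List.mem_cons_of_mem _ hi)), h j List.mem_cons_self]

lemma fold_main {n : ℕ} (f : (Fin n → ℂ) → ℂ) (hf : PW f) (x : Fin n → ℝ) (L : List (Fin n))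
    (hL : L.Nodup)
    (H : ∀ k : Fin n → Fin 2, ∀ y : Fin n → ℝ, (∀ j, j ∉ L → y j = x j) →
      (∀ j ∈ L, ∃ m : ℤ, y j = 2 * m) →
      L.foldr (fun j g => (pderivC j)^[(k j : ℕ)] g) f (fun i => (y i : ℂ)) = 0) :
    f (fun i => (x i : ℂ)) = 0 := by
  induction L with
  | nil => exact H 0 x (fun _ _ => rfl) (by simp)
  | cons j L ih =>
    rw [List.nodup_cons] at hL
    refine ih hL.2 fun k y hy1 hy2 => ?_
    have hpt : ∀ (b : Fin 2) (m : ℤ),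
        (pderivC j)^[(b : ℕ)] (L.foldr (fun j g => (pderivC j)^[(k j : ℕ)] g) f)
          (fun i => ((Function.update y j (2 * m : ℝ) i : ℝ) : ℂ)) = 0 := by
      intro b m
      have := H (Function.update k j b) (Function.update y j (2 * m : ℝ)) ?_ ?_
      · rw [List.foldr_cons, fold_congr f _ (fun i => (k i : ℕ)) L] at this
        · simpa using this
        · intro i hi
          have : i ≠ j := by rintro rfl; exact hL.1 hi
          simp [this]
      · intro i hi
        rw [List.mem_cons, not_or] at hi
        rw [Function.update_of_ne hi.1]
        exact hy1 i hi.2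
      · intro i hi
        by_cases hij : i = j
        · subst hij; exact ⟨m, by simp⟩
        · rw [Function.update_of_ne hij]
          exact hy2 i ((List.mem_cons.1 hi).resolve_left hij)
    refine (hf.fold _ L).line j y (fun m => ?_) (fun m => ?_)
    · simpa using hpt 0 m
    · simpa using hpt 1 m

lemma zero_of_real {n : ℕ} (f : (Fin n → ℂ) → ℂ) (hf : Differentiable ℂ f)
    (h : ∀ x : Fin n → ℝ, f (fun i => (x i : ℂ)) = 0) (S : Finset (Fin n)) :
    ∀ z : Fin n → ℂ, (∀ i, i ∉ S → (z i).im = 0) → f z = 0 := by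
  induction S using Finset.induction_on with
  | empty =>
    intro z hz
    have : z = fun i => ((z i).re : ℂ) := by
      funext i
      apply Complex.ext <;> simp [hz i]
    rw [this]; exact h _
  | insert j S hj ih =>
    intro z hz
    set z0 := Function.update z j 0 with hz0
    have hd : Differentiable ℂ (fun w : ℂ => f (z0 + w • Pi.single j 1)) :=
      fun w => (slice_hasDerivAt f hf j z0 w).differentiableAt
    have hr : ∀ t : ℝ, f (z0 + (t : ℂ) • Pi.single j 1) = 0 := by
      intro t
      rw [hz0, ← update_eq]
      refine ih _ fun i hi => ?_
      by_cases hij : i = j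
      · subst hij; simp
      · rw [Function.update_of_ne hij]; exact hz i (by simp [hij, hi])
    have hfr : ∃ᶠ w in nhdsWithin (0:ℂ) {0}ᶜ, f (z0 + w • Pi.single j 1) = (0 : ℂ → ℂ) w := by
      have ht : Tendsto (fun m : ℕ => ((1 / ((m : ℝ) + 1) : ℝ) : ℂ)) atTop
          (nhdsWithin (0:ℂ) {0}ᶜ) := by
        rw [tendsto_nhdsWithin_iff]
        constructor
        · have := (Complex.continuous_ofReal.tendsto 0).comp tendsto_one_div_add_atTop_nhds_zero_nat
          rw [Complex.ofReal_zero] at this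
          exact this
        · refine Eventually.of_forall fun m => ?_
          have : ((m : ℝ) + 1) ≠ 0 := by positivity
          simp only [Set.mem_compl_iff, Set.mem_singleton_iff, Complex.ofReal_eq_zero]
          positivity
      exact ht.frequently (Frequently.of_forall fun m => by rw [hr]; rfl)
    have := AnalyticOnNhd.eq_of_frequently_eq
      (Complex.analyticOnNhd_univ_iff_differentiable.2 hd)
      (Complex.analyticOnNhd_univ_iff_differentiable.2 (differentiable_const (0:ℂ))) hfr
    have h2 := congrFun this (z j)
    beta_reduce at h2
    rw [hz0, ← update_eq, Function.update_eq_self] at h2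
    exact h2

/-- **Proposition 2.3**: an entire function of exponential type `(π,…,π)` whose
restriction to `ℝⁿ` is continuous and vanishes at infinity, all of whose sample data
`∂^k f (u)` with `k ∈ Eⁿ` and `u ∈ 2ℤⁿ` vanish, is identically zero. -/
theorem eq_zero_of_samples_vanish {n : ℕ}
    (f : (Fin n → ℂ) → ℂ) (hf : Differentiable ℂ f)
    (C : ℝ) (hC : ∀ z, ‖f z‖ ≤ C * Real.exp (Real.pi * ∑ j, |(z j).im|))
    (hcont : Continuous (fun x : Fin n → ℝ => f (fun j => (x j : ℂ))))
    (hzero : Tendsto (fun x : Fin n → ℝ => f (fun j => (x j : ℂ)))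
      (cocompact (Fin n → ℝ)) (nhds 0))
    (hsamples : ∀ k : Fin n → Fin 2, ∀ u : Fin n → ℤ,
      mixedPartial (fun j => (k j : ℕ)) f (fun j => ((2 * u j : ℤ) : ℂ)) = 0) :
    f = 0 := by
  have hPW : PW f := ⟨hf, ⟨C, hC⟩, hzero⟩
  have hreal : ∀ x : Fin n → ℝ, f (fun i => (x i : ℂ)) = 0 := by
    intro x
    refine fold_main f hPW x (List.finRange n) (List.nodup_finRange n) fun k y _ hy => ?_
    choose u hu using fun j => hy j (List.mem_finRange j)
    have := hsamples k u
    have e : (fun i => (y i : ℂ)) = fun j => ((2 * u j : ℤ) : ℂ) := by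
      funext i; rw [hu]; push_cast; rfl
    rw [e]; exact this
  funext z
  exact zero_of_real f hf hreal Finset.univ z (by simp)
end
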